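/- Let Ω = X×Y ⊂ ℝ^{n+1} be compact with Ω equal to the closure of its interior and X ⊂ ℝⁿ equal to the closure of its interior, and let μ be a Borel measure on Ω having a density f with respect to Lebesgue measure on ℝ^{n+1} that is bounded away from 0 on Ω (and vanishes outside Ω). Let φ be the marginal of μ on ℝⁿ and let (ν_{x,t})_t be any family of Borel measures on ℝ with positive definite moment matrices satisfying the factorization Λ^μ_t(x,y) = Λ^φ_t(x)·Λ^{ν_{x,t}}_t(y) for all y and t. If x ∈ int(X) and (x,y) ∉ Ω, then Λ^{ν_{x,t}}_t(y) → 0 exponentially fast as t → ∞, i.e., there exist C > 0 and r ∈ (0,1) such that Λ^{ν_{x,t}}_t(y) ≤ C r^t for all t. -/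

import Mathlib

open MeasureTheory Matrix

noncomputable section

/-- Multi-indices `α ∈ ℕⁿ` with `|α| ≤ t`, encoded with entries in `Fin (t+1)`. -/
def MIdx (n t : ℕ) : Type :=
  {α : Fin n → Fin (t + 1) // (∑ i, ((α i : ℕ))) ≤ t}

instance (n t : ℕ) : Fintype (MIdx n t) := by unfold MIdx; infer_instance

instance (n t : ℕ) : DecidableEq (MIdx n t) := by unfold MIdx; infer_instance

/-- The monomial `x^α`. -/
def mon {n t : ℕ} (x : Fin n → ℝ) (α : MIdx n t) : ℝ :=
  ∏ i, x i ^ ((α.1 i : ℕ))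

/-- Joint multi-indices `(α, k) ∈ ℕⁿ × ℕ` with `|α| + k ≤ t`, indexing the monomials
`x^α y^k` of degree at most `t` on `ℝⁿ × ℝ`. -/
def XYIdx (n t : ℕ) : Type :=
  {ak : (Fin n → Fin (t + 1)) × Fin (t + 1) //
    (∑ i, ((ak.1 i : ℕ))) + (ak.2 : ℕ) ≤ t}

instance (n t : ℕ) : Fintype (XYIdx n t) := by unfold XYIdx; infer_instance

instance (n t : ℕ) : DecidableEq (XYIdx n t) := by unfold XYIdx; infer_instance

/-- The monomial `x^α y^k`. -/
def monXY {n t : ℕ} (x : Fin n → ℝ) (y : ℝ) (γ : XYIdx n t) : ℝ :=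
  (∏ i, x i ^ ((γ.1.1 i : ℕ))) * y ^ ((γ.1.2 : ℕ))

/-- The moment matrix `M_t(μ)` of a measure `μ` on `ℝⁿ × ℝ`. -/
def momMatXY (n t : ℕ) (μ : Measure ((Fin n → ℝ) × ℝ)) :
    Matrix (XYIdx n t) (XYIdx n t) ℝ :=
  fun γ δ => ∫ z, monXY z.1 z.2 γ * monXY z.1 z.2 δ ∂μ

/-- The moment matrix `M_t(φ)` of a measure `φ` on `ℝⁿ`. -/
def momMatX (n t : ℕ) (φ : Measure (Fin n → ℝ)) : Matrix (MIdx n t) (MIdx n t) ℝ :=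
  fun α β => ∫ x, mon x α * mon x β ∂φ

/-- The Hankel moment matrix `M_t(ν)` of a measure `ν` on `ℝ`. -/
def hankelM (t : ℕ) (ν : Measure ℝ) : Matrix (Fin (t + 1)) (Fin (t + 1)) ℝ :=
  fun i j => ∫ y, y ^ ((i : ℕ) + (j : ℕ)) ∂ν

/-- The Christoffel function `Λ^μ_t(x,y)` of a measure `μ` on `ℝⁿ × ℝ`. -/
def CFXY (n t : ℕ) (μ : Measure ((Fin n → ℝ) × ℝ)) (x : Fin n → ℝ) (y : ℝ) : ℝ :=
  (monXY x y ⬝ᵥ (momMatXY n t μ)⁻¹.mulVec (monXY x y))⁻¹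

/-- The Christoffel function `Λ^φ_t(x)` of a measure `φ` on `ℝⁿ`. -/
def CFX (n t : ℕ) (φ : Measure (Fin n → ℝ)) (x : Fin n → ℝ) : ℝ :=
  (mon x ⬝ᵥ (momMatX n t φ)⁻¹.mulVec (mon x))⁻¹

/-- The Christoffel function `Λ^ν_t(y)` of a measure `ν` on `ℝ`. -/
def CFY (t : ℕ) (ν : Measure ℝ) (y : ℝ) : ℝ :=
  ((fun i : Fin (t + 1) => y ^ (i : ℕ)) ⬝ᵥ
    (hankelM t ν)⁻¹.mulVec (fun i : Fin (t + 1) => y ^ (i : ℕ)))⁻¹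


section GramMatrix

variable {E ι : Type*} [MeasurableSpace E]

/-- The Gram matrix of a finite family of functions in `L²(m)`. -/
def gramMat (m : Measure E) (v : E → ι → ℝ) : Matrix ι ι ℝ :=
  fun i j => ∫ z, v z i * v z j ∂m

lemma gramMat_isHermitian (m : Measure E) (v : E → ι → ℝ) : (gramMat m v).IsHermitian := by
  ext i j
  simp [gramMat, mul_comm]

variable [Fintype ι]

lemma sq_dotProduct_eq_sum (c w : ι → ℝ) :
    (c ⬝ᵥ w) ^ 2 = ∑ i, ∑ j, c i * c j * (w i * w j) := by
  rw [sq, dotProduct, Finset.sum_mul_sum]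
  exact Finset.sum_congr rfl fun i _ => Finset.sum_congr rfl fun j _ => by ring

lemma integrable_sq_dotProduct {m : Measure E} {v : E → ι → ℝ}
    (hv : ∀ i j, Integrable (fun z => v z i * v z j) m) (c : ι → ℝ) :
    Integrable (fun z => (c ⬝ᵥ v z) ^ 2) m := by
  simp only [sq_dotProduct_eq_sum]
  exact integrable_finsetSum _ fun i _ => integrable_finsetSum _ fun j _ =>
    (hv i j).const_mul _

lemma dotProduct_gramMat_mulVec {m : Measure E} {v : E → ι → ℝ}
    (hv : ∀ i j, Integrable (fun z => v z i * v z j) m) (c : ι → ℝ) :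
    c ⬝ᵥ gramMat m v *ᵥ c = ∫ z, (c ⬝ᵥ v z) ^ 2 ∂m := by
  simp only [sq_dotProduct_eq_sum]
  rw [integral_finsetSum _ fun i _ => integrable_finsetSum _ fun j _ => (hv i j).const_mul _]
  simp only [dotProduct, mulVec, Finset.mul_sum]
  refine Finset.sum_congr rfl fun i _ => ?_
  rw [integral_finsetSum _ fun j _ => (hv i j).const_mul _]
  refine Finset.sum_congr rfl fun j _ => ?_
  rw [integral_const_mul, gramMat]
  ring

variable [DecidableEq ι]

lemma Matrix.PosDef.mulVec_inv_mulVec {M : Matrix ι ι ℝ} (hM : M.PosDef) (w : ι → ℝ) :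
    M *ᵥ (M⁻¹ *ᵥ w) = w := by
  rw [mulVec_mulVec, mul_nonsing_inv _ ((isUnit_iff_isUnit_det M).mp hM.isUnit), one_mulVec]

/-- The Cauchy–Schwarz inequality for the pair of dual quadratic forms of `M` and `M⁻¹`. -/
lemma Matrix.PosDef.sq_dotProduct_le {M : Matrix ι ι ℝ} (hM : M.PosDef) (c w : ι → ℝ) :
    (c ⬝ᵥ w) ^ 2 ≤ (w ⬝ᵥ M⁻¹ *ᵥ w) * (c ⬝ᵥ M *ᵥ c) := by
  have hsymm : (M⁻¹ *ᵥ w) ⬝ᵥ M *ᵥ c = w ⬝ᵥ c := by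
    have hT : Mᵀ = M := by simpa using hM.isHermitian.eq
    rw [dotProduct_mulVec, ← mulVec_transpose, hT, hM.mulVec_inv_mulVec]
  have key : ∀ l : ℝ, 0 ≤ (w ⬝ᵥ M⁻¹ *ᵥ w) * (l * l) + (-2 * (c ⬝ᵥ w)) * l
      + c ⬝ᵥ M *ᵥ c := by
    intro l
    have h := hM.posSemidef.dotProduct_mulVec_nonneg (c - l • (M⁻¹ *ᵥ w))
    simp only [star_trivial, mulVec_sub, mulVec_smul, hM.mulVec_inv_mulVec, sub_dotProduct,
      dotProduct_sub, smul_dotProduct, dotProduct_smul, smul_eq_mul, hsymm] at h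
    rw [dotProduct_comm w c, dotProduct_comm (M⁻¹ *ᵥ w) w] at h
    linarith
  have := discrim_le_zero key
  rw [discrim] at this
  linarith

lemma Matrix.PosDef.dotProduct_inv_mulVec_nonneg {M : Matrix ι ι ℝ} (hM : M.PosDef)
    (w : ι → ℝ) : 0 ≤ w ⬝ᵥ M⁻¹ *ᵥ w := by
  simpa using hM.inv.posSemidef.dotProduct_mulVec_nonneg w

lemma Matrix.PosDef.dotProduct_inv_mulVec_pos {M : Matrix ι ι ℝ} (hM : M.PosDef)
    {w : ι → ℝ} (hw : w ≠ 0) : 0 < w ⬝ᵥ M⁻¹ *ᵥ w := by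
  simpa using hM.inv.dotProduct_mulVec_pos hw

/-- The variational upper bound for the Christoffel function. -/
lemma inv_dotProduct_gramMat_inv_le {m : Measure E} {v : E → ι → ℝ}
    (hv : ∀ i j, Integrable (fun z => v z i * v z j) m) (hM : (gramMat m v).PosDef)
    {c w : ι → ℝ} (hc : c ⬝ᵥ w = 1) :
    (w ⬝ᵥ (gramMat m v)⁻¹ *ᵥ w)⁻¹ ≤ ∫ z, (c ⬝ᵥ v z) ^ 2 ∂m := by
  have hw : w ≠ 0 := by
    rintro rfl
    simp at hc
  have h := hM.sq_dotProduct_le c w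
  rw [hc, dotProduct_gramMat_mulVec hv, one_pow] at h
  exact (inv_le_iff_one_le_mul₀' (hM.dotProduct_inv_mulVec_pos hw)).2 h

/-- If evaluation at a point is bounded on the span of the family, then so is the
reciprocal of the Christoffel function. -/
lemma dotProduct_gramMat_inv_le {m : Measure E} {v : E → ι → ℝ}
    (hv : ∀ i j, Integrable (fun z => v z i * v z j) m) (hM : (gramMat m v).PosDef)
    {w : ι → ℝ} {D : ℝ} (hD : 0 ≤ D)
    (h : ∀ c : ι → ℝ, (c ⬝ᵥ w) ^ 2 ≤ D * ∫ z, (c ⬝ᵥ v z) ^ 2 ∂m) :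
    w ⬝ᵥ (gramMat m v)⁻¹ *ᵥ w ≤ D := by
  have h1 := h ((gramMat m v)⁻¹ *ᵥ w)
  rw [← dotProduct_gramMat_mulVec hv, hM.mulVec_inv_mulVec, dotProduct_comm] at h1
  rcases (hM.dotProduct_inv_mulVec_nonneg w).eq_or_lt with h0 | h0
  · exact h0 ▸ hD
  · rw [sq] at h1
    exact le_of_mul_le_mul_right h1 h0

lemma dotProduct_inv_mulVec_eq_sum (M : Matrix ι ι ℝ) (w : ι → ℝ) :
    w ⬝ᵥ M⁻¹ *ᵥ w = ∑ i, ∑ j, M⁻¹ i j * (w i * w j) := by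
  simp only [dotProduct, mulVec, Finset.mul_sum]
  exact Finset.sum_congr rfl fun i _ => Finset.sum_congr rfl fun j _ => by ring

lemma integrable_dotProduct_inv_mulVec {m : Measure E} {v : E → ι → ℝ}
    (hv : ∀ i j, Integrable (fun z => v z i * v z j) m) (M : Matrix ι ι ℝ) :
    Integrable (fun z => v z ⬝ᵥ M⁻¹ *ᵥ v z) m := by
  simp only [dotProduct_inv_mulVec_eq_sum]
  exact integrable_finsetSum _ fun i _ => integrable_finsetSum _ fun j _ =>
    (hv i j).const_mul _

lemma integral_dotProduct_inv_mulVec {m : Measure E} {v : E → ι → ℝ}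
    (hv : ∀ i j, Integrable (fun z => v z i * v z j) m) (M : Matrix ι ι ℝ) :
    ∫ z, v z ⬝ᵥ M⁻¹ *ᵥ v z ∂m = (M⁻¹ * gramMat m v).trace := by
  have h (a : ι → ι → ℝ) : ∫ z, ∑ i, ∑ j, a i j * (v z i * v z j) ∂m
      = ∑ i, ∑ j, a i j * ∫ z, v z i * v z j ∂m := by
    rw [integral_finsetSum _ fun i _ => integrable_finsetSum _ fun j _ => (hv i j).const_mul _]
    refine Finset.sum_congr rfl fun i _ => ?_
    rw [integral_finsetSum _ fun j _ => (hv i j).const_mul _]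
    exact Finset.sum_congr rfl fun j _ => integral_const_mul _ _
  simp only [dotProduct_inv_mulVec_eq_sum]
  refine (h fun i j => M⁻¹ i j).trans ?_
  simp only [trace, diag_apply, mul_apply]
  exact Finset.sum_congr rfl fun i _ => Finset.sum_congr rfl fun j _ => by
    simp only [gramMat, mul_comm]

/-- The reciprocal of the Christoffel function integrates to the dimension. -/
lemma integral_dotProduct_gramMat_inv {m : Measure E} {v : E → ι → ℝ}
    (hv : ∀ i j, Integrable (fun z => v z i * v z j) m) (hM : (gramMat m v).PosDef) :
    ∫ z, v z ⬝ᵥ (gramMat m v)⁻¹ *ᵥ v z ∂m = Fintype.card ι := by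
  rw [integral_dotProduct_inv_mulVec hv,
    nonsing_inv_mul _ ((isUnit_iff_isUnit_det _).mp hM.isUnit), trace_one]

end GramMatrix

section Polynomials

variable {n t : ℕ}

/-- The multi-index `α` as an exponent vector of `MvPolynomial`. -/
def MIdx.toFinsupp (α : MIdx n t) : Fin n →₀ ℕ :=
  Finsupp.equivFunOnFinite.symm fun i => (α.1 i : ℕ)

lemma MIdx.toFinsupp_apply (α : MIdx n t) (i : Fin n) : α.toFinsupp i = (α.1 i : ℕ) := rfl

lemma MIdx.toFinsupp_injective : Function.Injective (MIdx.toFinsupp (n := n) (t := t)) := by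
  intro α β h
  refine Subtype.ext (funext fun i => Fin.ext ?_)
  exact DFunLike.congr_fun h i

lemma MIdx.exists_toFinsupp_eq {d : Fin n →₀ ℕ} (hd : ∑ i, d i ≤ t) :
    ∃ α : MIdx n t, α.toFinsupp = d := by
  have h : ∀ i, d i < t + 1 := fun i =>
    Nat.lt_succ_of_le ((Finset.single_le_sum (f := fun i => d i) (fun _ _ => Nat.zero_le _)
      (Finset.mem_univ i)).trans hd)
  exact ⟨⟨fun i => ⟨d i, h i⟩, hd⟩, Finsupp.ext fun i => rfl⟩

lemma MIdx.card_le : Fintype.card (MIdx n t) ≤ (t + 1) ^ n := by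
  refine (Fintype.card_le_of_injective (fun α : MIdx n t => α.1) Subtype.val_injective).trans ?_
  simp

/-- Polynomials of total degree at most `t` are linear combinations of the monomials
indexed by `MIdx n t`. -/
lemma exists_dotProduct_mon_eq_eval {P : MvPolynomial (Fin n) ℝ} (hP : P.totalDegree ≤ t) :
    ∃ c : MIdx n t → ℝ, ∀ z, c ⬝ᵥ mon z = MvPolynomial.eval z P := by
  refine ⟨fun α => P.coeff α.toFinsupp, fun z => ?_⟩
  rw [MvPolynomial.eval_eq', dotProduct]
  refine Finset.sum_bij_ne_zero (fun α _ _ => α.toFinsupp) ?_ ?_ ?_ ?_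
  · intro α _ h
    exact MvPolynomial.mem_support_iff.2 (left_ne_zero_of_mul h)
  · intro α _ _ β _ _ h
    exact MIdx.toFinsupp_injective h
  · intro d hd _
    obtain ⟨α, rfl⟩ := MIdx.exists_toFinsupp_eq (t := t) (d := d) (by
      have := (MvPolynomial.le_totalDegree hd).trans hP
      rwa [Finsupp.sum_fintype _ _ fun _ => rfl] at this)
    exact ⟨α, Finset.mem_univ _, by assumption, rfl⟩
  · intro α _ _
    rfl

/-- The space of polynomials of degree at most `t` is invariant under translations. -/
lemma exists_dotProduct_mon_add (c : MIdx n t → ℝ) (a : Fin n → ℝ) :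
    ∃ c' : MIdx n t → ℝ, ∀ z, c' ⬝ᵥ mon z = c ⬝ᵥ mon (z + a) := by
  obtain ⟨c', hc'⟩ := exists_dotProduct_mon_eq_eval (n := n) (t := t)
    (P := ∑ α, MvPolynomial.C (c α) * ∏ i, (MvPolynomial.X i + MvPolynomial.C (a i)) ^ (α.1 i : ℕ))
    (by
      refine MvPolynomial.totalDegree_finsetSum_le fun α _ => ?_
      refine (MvPolynomial.totalDegree_mul _ _).trans ?_
      rw [MvPolynomial.totalDegree_C, zero_add]
      refine (MvPolynomial.totalDegree_finsetProd _ _).trans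
        ((Finset.sum_le_sum fun i _ => ?_).trans α.2)
      refine (MvPolynomial.totalDegree_pow _ _).trans ?_
      refine (Nat.mul_le_mul_left _ ((MvPolynomial.totalDegree_add _ _).trans ?_)).trans
        (mul_one _).le
      simp)
  refine ⟨c', fun z => ?_⟩
  rw [hc' z]
  simp [dotProduct, mon]

lemma eq_zero_of_dotProduct_mon_eq_zero {c : MIdx n t → ℝ} {s : Fin n → Set ℝ}
    (hs : ∀ i, (s i).Infinite) (h : ∀ z ∈ Set.pi Set.univ s, c ⬝ᵥ mon z = 0) : c = 0 := by
  have hP : ∑ α, MvPolynomial.monomial α.toFinsupp (c α) = 0 := by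
    refine MvPolynomial.funext_set s hs fun z hz => ?_
    rw [map_sum, map_zero, ← h z hz, dotProduct]
    refine Finset.sum_congr rfl fun α _ => ?_
    rw [MvPolynomial.eval_monomial, Finsupp.prod_fintype _ _ fun _ => pow_zero _]
    rfl
  ext β
  have := congrArg (MvPolynomial.coeff β.toFinsupp) hP
  simpa [MvPolynomial.coeff_sum, MvPolynomial.coeff_monomial,
    MIdx.toFinsupp_injective.eq_iff] using this

lemma continuous_mon (α : MIdx n t) : Continuous fun z : Fin n → ℝ => mon z α := by
  unfold mon
  fun_prop

lemma continuous_monXY (γ : XYIdx n t) :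
    Continuous fun z : (Fin n → ℝ) × ℝ => monXY z.1 z.2 γ := by
  unfold monXY
  fun_prop

lemma mon_ne_zero (x : Fin n → ℝ) : (mon x : MIdx n t → ℝ) ≠ 0 := by
  obtain ⟨α, hα⟩ := MIdx.exists_toFinsupp_eq (n := n) (t := t) (d := 0) (by simp)
  have h : ∀ i, (α.1 i : ℕ) = 0 := fun i => DFunLike.congr_fun hα i
  intro h0
  have := congrFun h0 α
  simp [mon, h] at this

/-- The multi-index `(α, 0)`. -/
def MIdx.toXYIdx (α : MIdx n t) : XYIdx n t := ⟨(α.1, 0), by simpa using α.2⟩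

lemma MIdx.toXYIdx_injective : Function.Injective (MIdx.toXYIdx (n := n) (t := t)) := by
  intro α β h
  exact Subtype.ext (congrArg (fun γ : XYIdx n t => γ.1.1) h)

lemma monXY_toXYIdx (x : Fin n → ℝ) (y : ℝ) (α : MIdx n t) :
    monXY x y α.toXYIdx = mon x α := by
  simp [monXY, mon, MIdx.toXYIdx]

/-- The multi-index `(0, k)`. -/
def XYIdx.ofFin (k : Fin (t + 1)) : XYIdx n t :=
  ⟨(0, k), by simpa using Nat.le_of_lt_succ k.2⟩

lemma XYIdx.ofFin_injective : Function.Injective (XYIdx.ofFin (n := n) (t := t)) := by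
  intro j k h
  exact congrArg (fun γ : XYIdx n t => γ.1.2) h

lemma monXY_ofFin (x : Fin n → ℝ) (y : ℝ) (k : Fin (t + 1)) :
    (monXY x y (XYIdx.ofFin k) : ℝ) = y ^ (k : ℕ) := by
  simp [monXY, XYIdx.ofFin]

lemma exists_dotProduct_monXY_eq_eval {p : Polynomial ℝ} (hp : p.natDegree ≤ t) :
    ∃ c : XYIdx n t → ℝ, ∀ x y, c ⬝ᵥ monXY x y = p.eval y := by
  refine ⟨fun γ => if γ.1.1 = 0 then p.coeff γ.1.2 else 0, fun x y => ?_⟩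
  rw [Polynomial.eval_eq_sum_range' (Nat.lt_succ_of_le hp), ← Fin.sum_univ_eq_sum_range
    (fun k => p.coeff k * y ^ k), dotProduct]
  symm
  refine Finset.sum_of_injOn XYIdx.ofFin XYIdx.ofFin_injective.injOn (by simp) ?_ ?_
  · intro γ _ hγ
    have h0 : γ.1.1 ≠ 0 := by
      intro h0
      exact hγ ⟨γ.1.2, by simp, Subtype.ext (Prod.ext h0.symm rfl)⟩
    simp [h0]
  · intro k _
    rw [monXY_ofFin]
    simp [XYIdx.ofFin]

end Polynomials

section LowerBound

variable {n t : ℕ}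

lemma integrable_of_continuous_of_measure_compl {E : Type*} [MeasurableSpace E]
    [TopologicalSpace E] [T2Space E] [OpensMeasurableSpace E] {m : Measure E}
    [IsFiniteMeasureOnCompacts m] {K : Set E} (hK : IsCompact K) (hm : m Kᶜ = 0)
    {g : E → ℝ} (hg : Continuous g) : Integrable g m := by
  have h : m.restrict K = m := Measure.restrict_eq_self_of_ae_mem (mem_ae_iff.2 hm)
  rw [← h]
  exact hg.continuousOn.integrableOn_compact hK

lemma integrable_mon_mul_mon (x : Fin n → ℝ) (r : ℝ) (α β : MIdx n t) :
    Integrable (fun z => mon z α * mon z β) (volume.restrict (Metric.closedBall x r)) :=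
  ((continuous_mon α).mul (continuous_mon β)).continuousOn.integrableOn_compact
    (isCompact_closedBall x r)

lemma continuous_sq_dotProduct_mon (c : MIdx n t → ℝ) :
    Continuous fun z : Fin n → ℝ => (c ⬝ᵥ mon z) ^ 2 := by
  simp only [dotProduct]
  exact (continuous_finsetSum _ fun α _ => continuous_const.mul (continuous_mon α)).pow 2

lemma posDef_gramMat_closedBall {h : ℝ} (hh : 0 < h) :
    (gramMat (volume.restrict (Metric.closedBall (0 : Fin n → ℝ) h))
      (mon : (Fin n → ℝ) → MIdx n t → ℝ)).PosDef := by
  refine PosDef.of_dotProduct_mulVec_pos (gramMat_isHermitian _ _) fun c hc => ?_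
  rw [star_trivial, dotProduct_gramMat_mulVec (integrable_mon_mul_mon 0 h)]
  refine (integral_nonneg fun z => sq_nonneg _).lt_of_ne' fun h0 => hc ?_
  rw [integral_eq_zero_iff_of_nonneg (fun z => sq_nonneg _)
    (integrable_sq_dotProduct (integrable_mon_mul_mon 0 h) c)] at h0
  have h1 := Measure.eqOn_open_of_ae_eq
    (ae_restrict_of_ae_restrict_of_subset Metric.ball_subset_closedBall h0) Metric.isOpen_ball
    (continuous_sq_dotProduct_mon c).continuousOn continuousOn_const
  refine eq_zero_of_dotProduct_mon_eq_zero (s := fun i => Metric.ball ((0 : Fin n → ℝ) i) h)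
    (fun i => ?_) fun z hz => ?_
  · rw [Real.ball_eq_Ioo]
    exact Set.Ioo_infinite (by linarith)
  · rw [← ball_pi _ hh] at hz
    exact pow_eq_zero_iff two_ne_zero |>.1 (h1 hz)

/-- Point evaluation on polynomials of degree at most `t` is bounded in `L²` of a ball around
the point, with a constant growing only polynomially in `t`. -/
lemma sq_dotProduct_mon_le (x : Fin n → ℝ) {h : ℝ} (hh : 0 < h) (c : MIdx n t → ℝ) :
    volume.real (Metric.closedBall (0 : Fin n → ℝ) h) * (c ⬝ᵥ mon x) ^ 2 ≤
      Fintype.card (MIdx n t) * ∫ z in Metric.closedBall x (2 * h), (c ⬝ᵥ mon z) ^ 2 := by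
  set S := Metric.closedBall (0 : Fin n → ℝ) h with hS
  set G := gramMat (volume.restrict S) (mon : (Fin n → ℝ) → MIdx n t → ℝ) with hG
  have hGpos : G.PosDef := posDef_gramMat_closedBall hh
  have hint := integrable_mon_mul_mon (t := t) (0 : Fin n → ℝ) h
  set I := ∫ z in Metric.closedBall x (2 * h), (c ⬝ᵥ mon z) ^ 2 with hI
  have hpt : ∀ s ∈ S, (c ⬝ᵥ mon x) ^ 2 ≤ (mon s ⬝ᵥ G⁻¹ *ᵥ mon s) * I := by
    intro s hs
    obtain ⟨c', hc'⟩ := exists_dotProduct_mon_add c (x - s)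
    have h1 := hGpos.sq_dotProduct_le c' (mon s)
    rw [hc' s, add_sub_cancel, hG, dotProduct_gramMat_mulVec hint] at h1
    refine h1.trans (mul_le_mul_of_nonneg_left ?_ (hGpos.dotProduct_inv_mulVec_nonneg _))
    simp only [hc']
    have hshift := (measurePreserving_add_right volume (x - s)).setIntegral_preimage_emb
      (MeasurableEquiv.addRight (x - s)).measurableEmbedding (fun z => (c ⬝ᵥ mon z) ^ 2)
      (Metric.closedBall x (2 * h))
    rw [hI, ← hshift]
    refine setIntegral_mono_set ?_
      (Filter.Eventually.of_forall fun z => sq_nonneg (c ⬝ᵥ mon (z + (x - s)))) ?_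
    · exact ((measurePreserving_add_right volume (x - s)).integrableOn_comp_preimage
        (MeasurableEquiv.addRight (x - s)).measurableEmbedding).2
        ((continuous_sq_dotProduct_mon c).continuousOn.integrableOn_compact
          (isCompact_closedBall x (2 * h)))
    · refine Filter.Eventually.of_forall fun z hz => ?_
      change z + (x - s) ∈ Metric.closedBall x (2 * h)
      have hz' : ‖z‖ ≤ h := mem_closedBall_zero_iff.1 hz
      have hs' : ‖s‖ ≤ h := mem_closedBall_zero_iff.1 hs
      rw [mem_closedBall_iff_norm, show z + (x - s) - x = z - s by abel]
      linarith [norm_sub_le z s]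
  have h2 := setIntegral_mono_on (μ := volume) (s := S) (f := fun _ => (c ⬝ᵥ mon x) ^ 2)
    (integrableOn_const (isCompact_closedBall _ _).measure_lt_top.ne)
    ((integrable_dotProduct_inv_mulVec hint G).mul_const I)
    (isCompact_closedBall _ _).measurableSet hpt
  rwa [setIntegral_const, integral_mul_const, integral_dotProduct_gramMat_inv hint hGpos,
    smul_eq_mul] at h2

end LowerBound

section Decay

lemma exists_pow_mul_pow_le (n : ℕ) {ρ : ℝ} (h0 : 0 < ρ) (h1 : ρ < 1) :
    ∃ A > (0 : ℝ), ∃ r ∈ Set.Ioo (0 : ℝ) 1, ∀ t : ℕ,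
      ((t : ℝ) + 1) ^ n * ρ ^ (2 * (t / 2)) ≤ A * r ^ t := by
  obtain ⟨r, hρr, hr1⟩ := exists_between h1
  have hr0 : 0 < r := h0.trans hρr
  have hs0 : 0 < ρ / r := div_pos h0 hr0
  have hs1 : ρ / r < 1 := (div_lt_one hr0).2 hρr
  obtain ⟨A, hA⟩ := (tendsto_pow_const_mul_const_pow_of_abs_lt_one n
    (r := ρ / r) (by rwa [abs_of_pos hs0])).bddAbove_range
  have hA' : ∀ t : ℕ, ((t : ℝ) + 1) ^ n * (ρ / r) ^ (t + 1) ≤ A := fun t => by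
    have := hA ⟨t + 1, rfl⟩
    simpa using this
  have hApos : 0 < A := lt_of_lt_of_le (by positivity) (hA' 0)
  refine ⟨A / (ρ / r * ρ), by positivity, r, ⟨hr0, hr1⟩, fun t => ?_⟩
  rw [div_mul_eq_mul_div, le_div_iff₀ (by positivity)]
  have hpow : ρ ^ (2 * (t / 2)) * ρ ≤ ρ ^ t := by
    rw [← pow_succ]
    exact pow_le_pow_of_le_one h0.le h1.le (by omega)
  calc ((t : ℝ) + 1) ^ n * ρ ^ (2 * (t / 2)) * (ρ / r * ρ)
      = ((t : ℝ) + 1) ^ n * (ρ / r) * (ρ ^ (2 * (t / 2)) * ρ) := by ring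
    _ ≤ ((t : ℝ) + 1) ^ n * (ρ / r) * ρ ^ t := by gcongr
    _ = ((t : ℝ) + 1) ^ n * (ρ / r) ^ (t + 1) * r ^ t := by
        rw [pow_succ, div_pow]
        field_simp
    _ ≤ A * r ^ t := by gcongr; exact hA' t

/-- A univariate quadratic polynomial peaking at a point off a compact set. -/
lemma exists_peak_polynomial {Y : Set ℝ} (hY : IsCompact Y) {y : ℝ} (hy : y ∉ Y) :
    ∃ ρ ∈ Set.Ioo (0 : ℝ) 1, ∃ q : Polynomial ℝ, q.natDegree ≤ 2 ∧ q.eval y = 1 ∧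
      ∀ z ∈ Y, |q.eval z| ≤ ρ := by
  obtain ⟨δ, hδ, hδY⟩ : ∃ δ > 0, ∀ z ∈ Y, δ ≤ |z - y| := by
    obtain ⟨δ, hδ, h⟩ := Metric.isOpen_iff.1 hY.isClosed.isOpen_compl y hy
    exact ⟨δ, hδ, fun z hz => not_lt.1 fun hlt => h (Metric.mem_ball.2 hlt) hz⟩
  obtain ⟨R₀, hR₀⟩ := hY.isBounded.subset_closedBall y
  set R := max R₀ (δ + 1) with hR
  have hRδ : δ < R := lt_of_lt_of_le (by linarith) (le_max_right _ _)
  have hR0 : 0 < R := hδ.trans hRδ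
  have hRY : ∀ z ∈ Y, |z - y| ≤ R := fun z hz =>
    (Metric.mem_closedBall.1 (hR₀ hz)).trans (le_max_left _ _)
  have hδR : (δ / R) ^ 2 < 1 :=
    pow_lt_one₀ (by positivity) ((div_lt_one hR0).2 hRδ) two_ne_zero
  have hδR' : 0 < (δ / R) ^ 2 := by positivity
  refine ⟨1 - (δ / R) ^ 2, ⟨by linarith, by linarith⟩,
    1 - Polynomial.C (R⁻¹ ^ 2) * (Polynomial.X - Polynomial.C y) ^ 2, by compute_degree,
    by simp, fun z hz => ?_⟩
  have h1 : (δ / R) ^ 2 ≤ (|z - y| / R) ^ 2 := by gcongr; exact hδY z hz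
  have h2 : (|z - y| / R) ^ 2 ≤ 1 :=
    pow_le_one₀ (by positivity) ((div_le_one hR0).2 (hRY z hz))
  have h3 : Polynomial.eval z
      (1 - Polynomial.C (R⁻¹ ^ 2) * (Polynomial.X - Polynomial.C y) ^ 2)
      = 1 - (|z - y| / R) ^ 2 := by
    simp only [Polynomial.eval_sub, Polynomial.eval_one, Polynomial.eval_mul, Polynomial.eval_C,
      Polynomial.eval_pow, Polynomial.eval_X, div_pow, sq_abs]
    ring
  rw [h3, abs_of_nonneg (by linarith)]
  linarith

end Decay

section Marginal

variable {n : ℕ} {X : Set (Fin n → ℝ)} {Y : Set ℝ} {f : (Fin n → ℝ) × ℝ → ℝ}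

lemma withDensity_compl_eq_zero (hΩ : MeasurableSet (X ×ˢ Y)) (hf0 : ∀ z ∉ X ×ˢ Y, f z = 0) :
    (volume.withDensity fun z => ENNReal.ofReal (f z)) (X ×ˢ Y)ᶜ = 0 := by
  rw [withDensity_apply _ hΩ.compl,
    setLIntegral_congr_fun hΩ.compl (g := fun _ => 0) fun z hz => by simp [hf0 z hz]]
  simp

lemma restrict_le_map_fst_withDensity {ε : ℝ} (hε : ∀ z ∈ X ×ˢ Y, ε ≤ f z)
    {B : Set (Fin n → ℝ)} (hB : MeasurableSet B) (hBX : B ⊆ X) (hY : MeasurableSet Y) :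
    (ENNReal.ofReal ε * volume Y) • (volume.restrict B) ≤
      (volume.withDensity fun z => ENNReal.ofReal (f z)).map Prod.fst := by
  refine Measure.le_iff.2 fun A hA => ?_
  rw [Measure.map_apply measurable_fst hA, withDensity_apply _ (measurable_fst hA),
    Measure.smul_apply, Measure.restrict_apply hA, smul_eq_mul]
  calc ENNReal.ofReal ε * volume Y * volume (A ∩ B)
      = ∫⁻ _ in (A ∩ B) ×ˢ Y, ENNReal.ofReal ε := by
        rw [setLIntegral_const, Measure.volume_eq_prod, Measure.prod_prod]
        ring
    _ ≤ ∫⁻ z in (A ∩ B) ×ˢ Y, ENNReal.ofReal (f z) :=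
        setLIntegral_mono' ((hA.inter hB).prod hY) fun z hz =>
          ENNReal.ofReal_le_ofReal (hε z ⟨hBX hz.1.2, hz.2⟩)
    _ ≤ ∫⁻ z in Prod.fst ⁻¹' A, ENNReal.ofReal (f z) :=
        lintegral_mono_set fun z hz => hz.1.1

lemma momMatX_map_fst (t : ℕ) (μ : Measure ((Fin n → ℝ) × ℝ)) :
    momMatX n t (μ.map Prod.fst) = (momMatXY n t μ).submatrix MIdx.toXYIdx MIdx.toXYIdx := by
  ext α β
  simp only [momMatX, momMatXY, submatrix_apply, monXY_toXYIdx]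
  exact integral_map measurable_fst.aemeasurable
    ((continuous_mon α).mul (continuous_mon β)).aestronglyMeasurable

end Marginal

/-- Let `Ω = X × Y ⊆ ℝⁿ × ℝ` be compact with `Ω` the closure of its interior and `X` the
closure of its interior, and let `μ` be a Borel measure with density `f` with respect to
Lebesgue measure, where `f` is bounded away from `0` on `Ω` and vanishes outside `Ω`
(so that `M_t(μ)` is positive definite for all `t`).  Let `φ` be the marginal of `μ` on
`ℝⁿ` and let `(ν_{x,t})_t` be any family of Borel measures on `ℝ` with positive definite
moment matrices satisfying `Λ^μ_t(x,y') = Λ^φ_t(x)·Λ^{ν_{x,t}}_t(y')` for all `y'` and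
`t`.  If `x ∈ int(X)` and `(x,y) ∉ Ω`, then `Λ^{ν_{x,t}}_t(y) → 0` exponentially fast:
there are `C > 0` and `r ∈ (0,1)` with `Λ^{ν_{x,t}}_t(y) ≤ C rᵗ` for all `t`. -/
theorem stmt11 (n : ℕ) (X : Set (Fin n → ℝ)) (Y : Set ℝ)
    (hΩc : IsCompact (X ×ˢ Y))
    (hΩcl : X ×ˢ Y = closure (interior (X ×ˢ Y)))
    (hXcl : X = closure (interior X))
    (f : (Fin n → ℝ) × ℝ → ℝ) (hf_meas : Measurable f)
    (μ : Measure ((Fin n → ℝ) × ℝ))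
    (hμ : μ = volume.withDensity (fun z => ENNReal.ofReal (f z)))
    (hflb : ∃ ε > (0 : ℝ), ∀ z ∈ X ×ˢ Y, ε ≤ f z)
    (hf0 : ∀ z ∉ X ×ˢ Y, f z = 0)
    (hPD : ∀ t : ℕ, (momMatXY n t μ).PosDef)
    (x : Fin n → ℝ) (y : ℝ) (hx : x ∈ interior X) (hxy : (x, y) ∉ X ×ˢ Y)
    (ν : ℕ → Measure ℝ)
    (hνPD : ∀ t : ℕ, (hankelM t (ν t)).PosDef)
    (hfact : ∀ (t : ℕ) (y' : ℝ),
      CFXY n t μ x y' = CFX n t (μ.map Prod.fst) x * CFY t (ν t) y') :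
    ∃ C > (0 : ℝ), ∃ r ∈ Set.Ioo (0 : ℝ) 1, ∀ t : ℕ, CFY t (ν t) y ≤ C * r ^ t := by
  obtain ⟨ε, hε, hεf⟩ := hflb
  have hμpos : 0 < μ.real Set.univ := by
    have h := (hPD 0).diag_pos (i := XYIdx.ofFin 0)
    simpa [momMatXY, monXY_ofFin] using h
  have hfin : IsFiniteMeasure μ :=
    ⟨lt_top_iff_ne_top.2 fun h => by simp [measureReal_def, h] at hμpos⟩
  have hμΩ : μ (X ×ˢ Y)ᶜ = 0 := hμ ▸ withDensity_compl_eq_zero hΩc.measurableSet hf0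
  have hxX : x ∈ X := interior_subset hx
  have hyY : y ∉ Y := fun h => hxy ⟨hxX, h⟩
  have hYne : Y.Nonempty := by
    rw [Set.nonempty_iff_ne_empty]
    rintro rfl
    rw [Set.prod_empty, Set.compl_empty] at hμΩ
    simp [measureReal_def, hμΩ] at hμpos
  have hYc : IsCompact Y := by
    have := hΩc.image continuous_snd
    rwa [Set.snd_image_prod ⟨x, hxX⟩] at this
  have hXc : IsCompact X := by
    have := hΩc.image continuous_fst
    rwa [Set.fst_image_prod _ hYne] at this
  have hYvol : 0 < volume Y := by
    have hne : (interior (X ×ˢ Y)).Nonempty := by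
      rw [← closure_nonempty_iff, ← hΩcl]
      exact Set.Nonempty.prod ⟨x, hxX⟩ hYne
    rw [interior_prod_eq] at hne
    exact Measure.measure_pos_of_nonempty_interior _ hne.snd
  obtain ⟨h, hh, hball⟩ : ∃ h > 0, Metric.closedBall x (2 * h) ⊆ X := by
    obtain ⟨r, hr, hrX⟩ := Metric.nhds_basis_closedBall.mem_iff.1 (mem_interior_iff_mem_nhds.1 hx)
    exact ⟨r / 2, half_pos hr, by rwa [mul_div_cancel₀ _ two_ne_zero]⟩
  set φ := μ.map Prod.fst with hφ
  set κ := ENNReal.ofReal ε * volume Y with hκ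
  have hκ0 : κ ≠ 0 := mul_ne_zero (ENNReal.ofReal_pos.2 hε).ne' hYvol.ne'
  have hκtop : κ ≠ ⊤ := ENNReal.mul_ne_top ENNReal.ofReal_ne_top hYc.measure_lt_top.ne
  have hκpos : 0 < κ.toReal := ENNReal.toReal_pos hκ0 hκtop
  have hle : κ • volume.restrict (Metric.closedBall x (2 * h)) ≤ φ := by
    rw [hφ, hμ]
    exact restrict_le_map_fst_withDensity hεf Metric.isClosed_closedBall.measurableSet hball
      hYc.measurableSet
  have hφX : φ Xᶜ = 0 := by
    rw [hφ, Measure.map_apply measurable_fst hXc.measurableSet.compl]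
    exact measure_mono_null (fun z hz (hz' : z ∈ X ×ˢ Y) => hz hz'.1) hμΩ
  have hφfin : IsFiniteMeasure φ := Measure.isFiniteMeasure_map μ _
  set V := volume.real (Metric.closedBall (0 : Fin n → ℝ) h) with hV
  have hVpos : 0 < V :=
    ENNReal.toReal_pos (Metric.measure_closedBall_pos _ _ hh).ne'
      (isCompact_closedBall _ _).measure_lt_top.ne
  have hX_upper : ∀ t : ℕ, 0 < CFX n t φ x ∧
      (CFX n t φ x)⁻¹ ≤ ((t : ℝ) + 1) ^ n / (V * κ.toReal) := by
    intro t
    have hpos : (gramMat φ (mon : (Fin n → ℝ) → MIdx n t → ℝ)).PosDef := by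
      have := (hPD t).submatrix MIdx.toXYIdx_injective
      rwa [← momMatX_map_fst] at this
    have hint : ∀ α β : MIdx n t, Integrable (fun z => mon z α * mon z β) φ := fun α β =>
      integrable_of_continuous_of_measure_compl hXc hφX
        ((continuous_mon α).mul (continuous_mon β))
    refine ⟨inv_pos.2 (hpos.dotProduct_inv_mulVec_pos (mon_ne_zero x)), ?_⟩
    rw [CFX, inv_inv]
    refine dotProduct_gramMat_inv_le hint hpos (by positivity) fun c => ?_
    have h1 := sq_dotProduct_mon_le x hh c
    have h2 : κ.toReal * ∫ z in Metric.closedBall x (2 * h), (c ⬝ᵥ mon z) ^ 2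
        ≤ ∫ z, (c ⬝ᵥ mon z) ^ 2 ∂φ := by
      rw [← smul_eq_mul, ← integral_smul_measure]
      exact integral_mono_measure hle (Filter.Eventually.of_forall fun z => sq_nonneg _)
        (integrable_sq_dotProduct hint c)
    have hcard : (Fintype.card (MIdx n t) : ℝ) ≤ ((t : ℝ) + 1) ^ n := by
      exact_mod_cast MIdx.card_le (n := n) (t := t)
    have hJ : 0 ≤ ∫ z, (c ⬝ᵥ mon z) ^ 2 ∂φ := integral_nonneg fun z => sq_nonneg _
    rw [div_mul_eq_mul_div, le_div_iff₀ (by positivity)]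
    calc (c ⬝ᵥ mon x) ^ 2 * (V * κ.toReal) = κ.toReal * (V * (c ⬝ᵥ mon x) ^ 2) := by ring
      _ ≤ κ.toReal * (Fintype.card (MIdx n t) *
            ∫ z in Metric.closedBall x (2 * h), (c ⬝ᵥ mon z) ^ 2) := by gcongr
      _ = Fintype.card (MIdx n t) *
            (κ.toReal * ∫ z in Metric.closedBall x (2 * h), (c ⬝ᵥ mon z) ^ 2) := by ring
      _ ≤ ((t : ℝ) + 1) ^ n * ∫ z, (c ⬝ᵥ mon z) ^ 2 ∂φ := by gcongr
  obtain ⟨ρ, ⟨hρ0, hρ1⟩, q, hqdeg, hqy, hqY⟩ := exists_peak_polynomial hYc hyY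
  have hXY_upper : ∀ t : ℕ, CFXY n t μ x y ≤ μ.real Set.univ * ρ ^ (2 * (t / 2)) := by
    intro t
    obtain ⟨c, hc⟩ := exists_dotProduct_monXY_eq_eval (n := n) (t := t) (p := q ^ (t / 2))
      (Polynomial.natDegree_pow_le.trans ((Nat.mul_le_mul_left _ hqdeg).trans (by omega)))
    have hint : ∀ γ δ : XYIdx n t,
        Integrable (fun z : (Fin n → ℝ) × ℝ => monXY z.1 z.2 γ * monXY z.1 z.2 δ) μ :=
      fun γ δ => integrable_of_continuous_of_measure_compl hΩc hμΩ
        ((continuous_monXY γ).mul (continuous_monXY δ))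
    refine (inv_dotProduct_gramMat_inv_le (v := fun z : (Fin n → ℝ) × ℝ => monXY z.1 z.2)
      hint (hPD t) (c := c) (by rw [hc, Polynomial.eval_pow, hqy, one_pow])).trans ?_
    have hmono : ∫ z, (c ⬝ᵥ monXY z.1 z.2) ^ 2 ∂μ ≤ ∫ _, ρ ^ (2 * (t / 2)) ∂μ := by
      refine integral_mono_ae (integrable_sq_dotProduct hint c) (integrable_const _) ?_
      filter_upwards [mem_ae_iff.2 hμΩ] with z hz
      rw [hc, Polynomial.eval_pow, ← pow_mul, mul_comm, pow_mul, ← sq_abs, ← pow_mul]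
      exact pow_le_pow_left₀ (abs_nonneg _) (hqY z.2 hz.2) _
    rwa [integral_const, smul_eq_mul] at hmono
  obtain ⟨A, hA, r, hr, hAr⟩ := exists_pow_mul_pow_le n hρ0 hρ1
  refine ⟨μ.real Set.univ / (V * κ.toReal) * A, by positivity, r, hr, fun t => ?_⟩
  obtain ⟨hpos, hinv⟩ := hX_upper t
  calc CFY t (ν t) y = CFXY n t μ x y * (CFX n t φ x)⁻¹ := by
        rw [hfact t y]
        field_simp
    _ ≤ (μ.real Set.univ * ρ ^ (2 * (t / 2))) * (((t : ℝ) + 1) ^ n / (V * κ.toReal)) :=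
        mul_le_mul (hXY_upper t) hinv (inv_pos.2 hpos).le (by positivity)
    _ = μ.real Set.univ / (V * κ.toReal) * (((t : ℝ) + 1) ^ n * ρ ^ (2 * (t / 2))) := by ring
    _ ≤ μ.real Set.univ / (V * κ.toReal) * (A * r ^ t) :=
        mul_le_mul_of_nonneg_left (hAr t) (by positivity)
    _ = μ.real Set.univ / (V * κ.toReal) * A * r ^ t := by ring
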